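/- arXiv:2603.22351 — 2 statements merged into one kernel-verified Lean document; each statement's English description precedes it below -/
import Mathlib

section
/- Let O, A, B be three pairwise distinct points in the plane. For any three integers n₁, n₂, n₃ with n₁ + n₂ = n₃, there exist open polygonal lines l₁, l₂, l₃, each beginning at A and ending at B and none of whose edges contain O, such that w(l₁·l₂⁻¹, O) = n₁, w(l₂·l₃⁻¹, O) = n₂ and w(l₁·l₃⁻¹, O) = n₃, where lᵢ·lⱼ⁻¹ denotes the closed polygonal line obtained by traversing lᵢ from A to B and then lⱼ in reverse from B back to A. -/
/-- The oriented angle `∠AOB ∈ (−π, π]` with vertex `O`. -/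
noncomputable def oangle (O A B : ℂ) : ℝ := Complex.arg ((B - O) / (A - O))

/-- The cyclic (oriented) edges of a closed polygonal line given by its list of vertices. -/
def cyc (l : List ℂ) : List (ℂ × ℂ) := l.zip (l.rotate 1)

/-- The (oriented) edges of an open polygonal line given by its list of vertices. -/
def opairs (l : List ℂ) : List (ℂ × ℂ) := l.zip l.tail

/-- The winding number of a closed polygonal line around `O`. -/
noncomputable def wind (l : List ℂ) (O : ℂ) : ℝ :=
  ((cyc l).map (fun e => oangle O e.1 e.2)).sum / (2 * Real.pi)

/-- `wconcat l l'` is the closed polygonal line obtained by traversing the open polygonal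
line `l` (from `A` to `B`) and then the open polygonal line `l'` (also from `A` to `B`)
in reverse, from `B` back to `A`. -/
def wconcat (l l' : List ℂ) : List ℂ := l ++ l'.reverse.tail.dropLast

/-- The total oriented angle swept around `O` along an open polygonal line. -/
noncomputable def sweep (O : ℂ) (l : List ℂ) : ℝ :=
  ((opairs l).map (fun e => oangle O e.1 e.2)).sum

theorem opairs_cons_cons (a b : ℂ) (l : List ℂ) :
    opairs (a :: b :: l) = (a, b) :: opairs (b :: l) := rfl

theorem sweep_cons_cons (O a b : ℂ) (l : List ℂ) :
    sweep O (a :: b :: l) = oangle O a b + sweep O (b :: l) := by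
  simp [sweep, opairs_cons_cons]

theorem sweep_singleton (O a : ℂ) : sweep O [a] = 0 := by
  simp [sweep, opairs]

theorem sweep_append_cons (O x : ℂ) (l r : List ℂ) :
    sweep O (l ++ x :: r) = sweep O (l ++ [x]) + sweep O (x :: r) := by
  induction l with
  | nil => simp [sweep_singleton]
  | cons a l ih =>
    cases l with
    | nil => simp [sweep_cons_cons, sweep_singleton]
    | cons b l =>
      simp only [List.cons_append, sweep_cons_cons] at ih ⊢
      rw [ih, add_assoc]

theorem oangle_swap {O A B : ℂ} (h : oangle O A B ≠ Real.pi) :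
    oangle O B A = -oangle O A B := by
  unfold oangle at *
  rw [← inv_div, Complex.arg_inv, if_neg h]

theorem sweep_reverse (O : ℂ) (l : List ℂ) (h : ∀ e ∈ opairs l, oangle O e.1 e.2 ≠ Real.pi) :
    sweep O l.reverse = -sweep O l := by
  induction l with
  | nil => simp [sweep, opairs]
  | cons a l ih =>
    cases l with
    | nil => simp [sweep_singleton]
    | cons b l =>
      simp only [opairs_cons_cons, List.forall_mem_cons] at h
      have ih := ih h.2
      rw [List.reverse_cons] at ih
      rw [List.reverse_cons, List.reverse_cons, List.append_assoc, List.singleton_append,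
        sweep_append_cons, ih, sweep_cons_cons, sweep_cons_cons, sweep_singleton,
        oangle_swap h.1]
      ring

theorem cyc_cons (a : ℂ) (l : List ℂ) : cyc (a :: l) = opairs (a :: l ++ [a]) := by
  have h : (a :: l ++ [a]).zip (l ++ [a]) = (a :: l).zip (l ++ [a]) := by
    have := List.zip_append (l₁ := a :: l) (r₁ := [a]) (l₂ := l ++ [a]) (r₂ := ([] : List ℂ))
      (by simp)
    simpa using this
  simpa [cyc, opairs] using h.symm

/-- The winding number of `l · l'⁻¹` is the difference of the total angles swept by `l` and `l'`. -/
theorem wind_wconcat (O A B : ℂ) (m m' : List ℂ)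
    (h : ∀ e ∈ opairs (A :: (m' ++ [B])), oangle O e.1 e.2 ≠ Real.pi) :
    wind (wconcat (A :: (m ++ [B])) (A :: (m' ++ [B]))) O =
      (sweep O (A :: (m ++ [B])) - sweep O (A :: (m' ++ [B]))) / (2 * Real.pi) := by
  have hc : wconcat (A :: (m ++ [B])) (A :: (m' ++ [B])) = A :: (m ++ B :: m'.reverse) := by
    simp [wconcat]
  have hs : sweep O (A :: (m ++ B :: m'.reverse) ++ [A]) =
      sweep O (A :: (m ++ [B])) - sweep O (A :: (m' ++ [B])) := by
    have h₁ := sweep_append_cons O B (A :: m) (m'.reverse ++ [A])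
    have h₂ := sweep_reverse O _ h
    simp only [List.reverse_cons, List.reverse_append, List.reverse_nil, List.nil_append,
      List.cons_append, List.append_assoc] at h₁ h₂ ⊢
    rw [h₁, h₂, sub_eq_add_neg]
  rw [hc, wind, cyc_cons, ← hs, sweep]

theorem notMem_segment_of_oangle_ne_pi {O A B : ℂ} (hA : A ≠ O) (hB : B ≠ O)
    (h : oangle O A B ≠ Real.pi) : O ∉ segment ℝ A B := by
  rintro ⟨a, b, ha, hb, hab, hO⟩
  have hA' : A - O ≠ 0 := sub_ne_zero.2 hA
  apply h
  unfold oangle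
  set z := (B - O) / (A - O) with hz
  have hz0 : z ≠ 0 := div_ne_zero (sub_ne_zero.2 hB) hA'
  have hB' : B = O + z * (A - O) := by rw [hz]; field_simp; ring
  have hab' : (a : ℂ) + b = 1 := by exact_mod_cast hab
  have key : (a : ℂ) + b * z = 0 := by
    rw [hB', Complex.real_smul, Complex.real_smul] at hO
    have : ((a : ℂ) + b * z) * (A - O) = 0 := by linear_combination hO - O * hab'
    exact (mul_eq_zero.1 this).resolve_right hA'
  have hre : a + b * z.re = 0 := by simpa using congrArg Complex.re key
  have him : b * z.im = 0 := by simpa using congrArg Complex.im key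
  have hb0 : b ≠ 0 := by
    rintro rfl
    simp at hre hab
    linarith
  have hi : z.im = 0 := (mul_eq_zero.1 him).resolve_left hb0
  have hr0 : z.re ≠ 0 := fun hr => hz0 (Complex.ext hr hi)
  have hbp : 0 < b := lt_of_le_of_ne hb hb0.symm
  refine Complex.arg_eq_pi_iff.2 ⟨lt_of_le_of_ne ?_ hr0, hi⟩
  by_contra! hpos
  have := mul_pos hbp hpos
  linarith

/-- There is a polygonal line from `A` to `B` whose edges avoid `O` and which sweeps a total
angle `θ` around `O`. -/
def Sweeps (O A B : ℂ) (θ : ℝ) : Prop :=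
  ∃ m : List ℂ,
    (∀ e ∈ opairs (A :: (m ++ [B])), O ∉ segment ℝ e.1 e.2 ∧ oangle O e.1 e.2 ≠ Real.pi) ∧
    sweep O (A :: (m ++ [B])) = θ

theorem oangle_add_mul (O : ℂ) {u : ℂ} (hu : u ≠ 0) (z : ℂ) :
    oangle O (O + u) (O + z * u) = Complex.arg z := by
  simp [oangle, hu]

theorem notMem_segment_add_mul (O : ℂ) {u z : ℂ} (hu : u ≠ 0) (hz : z ≠ 0)
    (hz' : Complex.arg z ≠ Real.pi) : O ∉ segment ℝ (O + u) (O + z * u) :=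
  notMem_segment_of_oangle_ne_pi (by simpa using hu) (by simp [hu, hz])
    (by rwa [oangle_add_mul O hu])

theorem sweeps_edge (O : ℂ) {u z : ℂ} (hu : u ≠ 0) (hz : z ≠ 0)
    (hz' : Complex.arg z ≠ Real.pi) : Sweeps O (O + u) (O + z * u) (Complex.arg z) := by
  refine ⟨[], ?_, ?_⟩
  · simpa [opairs, oangle_add_mul O hu, hz'] using notMem_segment_add_mul O hu hz hz'
  · simp [sweep_cons_cons, sweep_singleton, oangle_add_mul O hu]

theorem Sweeps.cons {O u z B : ℂ} {θ : ℝ} (hu : u ≠ 0) (hz : z ≠ 0)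
    (hz' : Complex.arg z ≠ Real.pi) (h : Sweeps O (O + z * u) B θ) :
    Sweeps O (O + u) B (Complex.arg z + θ) := by
  obtain ⟨m, hm, hs⟩ := h
  refine ⟨(O + z * u) :: m, ?_, ?_⟩
  · rw [List.cons_append, opairs_cons_cons, List.forall_mem_cons]
    refine ⟨⟨notMem_segment_add_mul O hu hz hz', ?_⟩, hm⟩
    rwa [oangle_add_mul O hu]
  · rw [List.cons_append, sweep_cons_cons, hs, oangle_add_mul O hu]

theorem Sweeps.add_turns {O u B ω : ℂ} {θ : ℝ} (hu : u ≠ 0) (hω : ω ^ 3 = 1)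
    (hω' : Complex.arg ω ≠ Real.pi) (h : Sweeps O (O + u) B θ) (n : ℕ) :
    Sweeps O (O + u) B (θ + n * (3 * Complex.arg ω)) := by
  have hω0 : ω ≠ 0 := by
    rintro rfl
    simp at hω
  induction n with
  | zero => simpa using h
  | succ n ih =>
    have hu3 : ω * (ω * (ω * u)) = u := by linear_combination u * hω
    rw [← hu3] at ih
    have h₁ := Sweeps.cons (mul_ne_zero hω0 (mul_ne_zero hω0 hu)) hω0 hω' ih
    have h₂ := Sweeps.cons (mul_ne_zero hω0 hu) hω0 hω' h₁
    have h₃ := Sweeps.cons hu hω0 hω' h₂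
    convert h₃ using 1
    push_cast
    ring

theorem arg_exp_real_mul_I {t : ℝ} (h₁ : -Real.pi < t) (h₂ : t ≤ Real.pi) :
    Complex.arg (Complex.exp (t * Complex.I)) = t := by
  rw [Complex.arg_exp_mul_I, toIocMod_eq_self]
  exact ⟨h₁, by linarith⟩

theorem Sweeps.add_int_turns {O u B : ℂ} {θ : ℝ} (hu : u ≠ 0) (h : Sweeps O (O + u) B θ)
    (k : ℤ) : Sweeps O (O + u) B (θ + k * (2 * Real.pi)) := by
  have hπ := Real.pi_pos
  obtain ⟨n, rfl | rfl⟩ := k.eq_nat_or_neg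
  · have ha := arg_exp_real_mul_I (t := 2 * Real.pi / 3) (by linarith) (by linarith)
    have := h.add_turns (ω := Complex.exp ((2 * Real.pi / 3 : ℝ) * Complex.I)) hu
      (by
        rw [← Complex.exp_nat_mul, Complex.exp_eq_one_iff]
        exact ⟨1, by push_cast; ring⟩)
      (by rw [ha]; linarith) n
    rw [ha] at this
    convert this using 1
    push_cast
    ring
  · have ha := arg_exp_real_mul_I (t := -(2 * Real.pi / 3)) (by linarith) (by linarith)
    have := h.add_turns (ω := Complex.exp ((-(2 * Real.pi / 3) : ℝ) * Complex.I)) hu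
      (by
        rw [← Complex.exp_nat_mul, Complex.exp_eq_one_iff]
        exact ⟨-1, by push_cast; ring⟩)
      (by rw [ha]; linarith) n
    rw [ha] at this
    convert this using 1
    push_cast
    ring

theorem exists_sweeps {O A B : ℂ} (hA : A ≠ O) (hB : B ≠ O) : ∃ θ, Sweeps O A B θ := by
  have hu : A - O ≠ 0 := sub_ne_zero.2 hA
  have hz0 : (B - O) / (A - O) ≠ 0 := div_ne_zero (sub_ne_zero.2 hB) hu
  obtain ⟨w, hw, hw'⟩ : ∃ w : ℂ, w * w = (B - O) / (A - O) ∧ Complex.arg w ≠ Real.pi := by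
    obtain ⟨w, hw⟩ := IsAlgClosed.exists_eq_mul_self ((B - O) / (A - O))
    by_cases hp : Complex.arg w = Real.pi
    · refine ⟨-w, by rw [hw]; ring, fun hn => ?_⟩
      have h₁ := (Complex.arg_eq_pi_iff.1 hp).1
      have h₂ := (Complex.arg_eq_pi_iff.1 hn).1
      rw [Complex.neg_re] at h₂
      linarith
    · exact ⟨w, hw.symm, hp⟩
  have hw0 : w ≠ 0 := by
    rintro rfl
    exact hz0 (by rw [← hw, mul_zero])
  have h := Sweeps.cons hu hw0 hw' (sweeps_edge O (mul_ne_zero hw0 hu) hw0 hw')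
  rw [← mul_assoc, hw, div_mul_cancel₀ _ hu, add_sub_cancel, add_sub_cancel] at h
  exact ⟨_, h⟩

theorem stmt8 (O A B : ℂ) (hOA : O ≠ A) (hOB : O ≠ B) (hAB : A ≠ B)
    (n₁ n₂ n₃ : ℤ) (hn : n₁ + n₂ = n₃) :
    ∃ l₁ l₂ l₃ : List ℂ,
      (l₁.head? = some A ∧ l₁.getLast? = some B ∧ ∀ e ∈ opairs l₁, O ∉ segment ℝ e.1 e.2) ∧
      (l₂.head? = some A ∧ l₂.getLast? = some B ∧ ∀ e ∈ opairs l₂, O ∉ segment ℝ e.1 e.2) ∧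
      (l₃.head? = some A ∧ l₃.getLast? = some B ∧ ∀ e ∈ opairs l₃, O ∉ segment ℝ e.1 e.2) ∧
      wind (wconcat l₁ l₂) O = (n₁ : ℝ) ∧
      wind (wconcat l₂ l₃) O = (n₂ : ℝ) ∧
      wind (wconcat l₁ l₃) O = (n₃ : ℝ) := by
  obtain ⟨θ, hθ⟩ := exists_sweeps hOA.symm hOB.symm
  have hk : ∀ k : ℤ, Sweeps O A B (θ + k * (2 * Real.pi)) := fun k => by
    have hu : A - O ≠ 0 := sub_ne_zero.2 hOA.symm
    have hA : O + (A - O) = A := add_sub_cancel O A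
    have h := Sweeps.add_int_turns (B := B) (θ := θ) hu (by rwa [hA]) k
    rwa [hA] at h
  choose m hm hs using hk
  have hw : ∀ j k : ℤ,
      wind (wconcat (A :: (m j ++ [B])) (A :: (m k ++ [B]))) O = j - k := fun j k => by
    rw [wind_wconcat O A B _ _ fun e he => (hm k e he).2, hs, hs]
    field_simp
    ring
  have hl : ∀ k : ℤ, (A :: (m k ++ [B])).head? = some A ∧
      (A :: (m k ++ [B])).getLast? = some B ∧
      ∀ e ∈ opairs (A :: (m k ++ [B])), O ∉ segment ℝ e.1 e.2 := fun k =>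
    ⟨rfl, by rw [← List.cons_append, List.getLast?_concat], fun e he => (hm k e he).1⟩
  refine ⟨_, _, _, hl n₁, hl 0, hl (-n₂), ?_, ?_, ?_⟩
  · simp [hw]
  · simp [hw]
  · simp [hw, ← hn]
end

section
/- Let l be a closed polygonal line and p an open polygonal line in the plane with initial point P₀ and terminal point P₁, such that the vertices of l together with the vertices of p are pairwise distinct and in general position. Then w(l, P₁) − w(l, P₀) = l · p, where l · p is the sum, over all pairs consisting of an oriented edge \vec{AB} of l and an oriented edge \vec{CD} of p whose underlying segments intersect, of the sign of that intersection point. -/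
/-- The cross product `det(z, w)` of two plane vectors. -/
def cross (z w : ℂ) : ℝ := z.re * w.im - z.im * w.re

open scoped Classical in
/-- The contribution of a pair of oriented edges `e`, `f` to the signed intersection
number: `0` if the underlying segments do not intersect, and otherwise the sign of the
intersection point (`+1` if the traversal `e.1 e.2 f.1` is clockwise, `−1` otherwise). -/
noncomputable def isect (e f : ℂ × ℂ) : ℝ :=
  if (segment ℝ e.1 e.2 ∩ segment ℝ f.1 f.2).Nonempty then
    (if cross (e.2 - e.1) (f.1 - e.1) < 0 then 1 else -1)
  else 0

/-- The sum of the signs of the intersection points over all pairs of oriented edges. -/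
noncomputable def signedSum (L P : List (ℂ × ℂ)) : ℝ :=
  (L.map (fun e => (P.map (fun f => isect e f)).sum)).sum

/-- A finite collection of points is in general position if the points are pairwise distinct,
no three of them lie on a common line, and no three of the segments joining pairs of them
have a common interior point. -/
def GenPos (pts : List ℂ) : Prop :=
  pts.Pairwise (· ≠ ·) ∧
  (∀ a ∈ pts, ∀ b ∈ pts, ∀ c ∈ pts, a ≠ b → a ≠ c → b ≠ c →
    ¬ Collinear ℝ ({a, b, c} : Set ℂ)) ∧
  (∀ a₁ ∈ pts, ∀ b₁ ∈ pts, ∀ a₂ ∈ pts, ∀ b₂ ∈ pts, ∀ a₃ ∈ pts, ∀ b₃ ∈ pts,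
    ({a₁, b₁} : Set ℂ) ≠ {a₂, b₂} → ({a₁, b₁} : Set ℂ) ≠ {a₃, b₃} →
    ({a₂, b₂} : Set ℂ) ≠ {a₃, b₃} →
    ¬ ∃ x, x ∈ openSegment ℝ a₁ b₁ ∧ x ∈ openSegment ℝ a₂ b₂ ∧ x ∈ openSegment ℝ a₃ b₃)

/-- The signed crossing of the negative real half-line by the segment from `z` to `w`: the defect
of additivity of `Complex.arg` on the quotient `w / z`, in multiples of `2π`. -/
noncomputable def argJump (z w : ℂ) : ℝ :=
  if z.im < 0 ∧ 0 < w.im ∧ cross z w < 0 then -1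
  else if 0 < z.im ∧ w.im < 0 ∧ 0 < cross z w then 1 else 0

lemma div_im_eq_cross (z w : ℂ) : (w / z).im = cross z w / Complex.normSq z := by
  rw [Complex.div_im, cross]
  ring

lemma exists_arg_div (z w : ℂ) (hz : z ≠ 0) (hw : w ≠ 0) :
    ∃ n : ℤ, (w / z).arg = w.arg - z.arg + 2 * Real.pi * n := by
  have h := Complex.arg_div_coe_angle hw hz
  rw [← Real.Angle.coe_sub, Real.Angle.angle_eq_iff_two_pi_dvd_sub] at h
  obtain ⟨n, hn⟩ := h
  exact ⟨n, by linarith⟩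

lemma arg_mem_Ioo_of_im_pos {z : ℂ} (h : 0 < z.im) : 0 < z.arg ∧ z.arg < Real.pi := by
  refine ⟨lt_of_le_of_ne (Complex.arg_nonneg_iff.2 h.le) fun h0 => ?_,
    lt_of_le_of_ne (Complex.arg_le_pi z) fun h0 => ?_⟩
  · exact h.ne' (Complex.arg_eq_zero_iff.1 h0.symm).2
  · exact h.ne' (Complex.arg_eq_pi_iff.1 h0).2

lemma arg_mem_Ioo_of_im_neg {z : ℂ} (h : z.im < 0) : -Real.pi < z.arg ∧ z.arg < 0 :=
  ⟨Complex.neg_pi_lt_arg z, Complex.arg_neg_iff.2 h⟩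

lemma arg_div_eq (z w : ℂ) (hz : z.im ≠ 0) (hw : w.im ≠ 0) (h : cross z w ≠ 0) :
    (w / z).arg = w.arg - z.arg + 2 * Real.pi * argJump z w := by
  have hz0 : z ≠ 0 := by rintro rfl; simp at hz
  have hw0 : w ≠ 0 := by rintro rfl; simp at hw
  obtain ⟨n, hn⟩ := exists_arg_div z w hz0 hw0
  have hpos : 0 < Complex.normSq z := Complex.normSq_pos.2 hz0
  have hpi := Real.pi_pos
  have key : ∀ m : ℤ, 2 * Real.pi * (m - 1) < 2 * Real.pi * (n : ℝ) →
      2 * Real.pi * (n : ℝ) < 2 * Real.pi * (m + 1) → n = m := by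
    intro m h1 h2
    have h1' := lt_of_mul_lt_mul_left h1 (by positivity)
    have h2' := lt_of_mul_lt_mul_left h2 (by positivity)
    have h3 : m - 1 < n := by exact_mod_cast h1'
    have h4 : n < m + 1 := by exact_mod_cast h2'
    omega
  have hc : (0 < cross z w ∧ 0 < (w / z).arg ∧ (w / z).arg < Real.pi) ∨
      (cross z w < 0 ∧ -Real.pi < (w / z).arg ∧ (w / z).arg < 0) := by
    rcases h.lt_or_gt with h | h
    · exact .inr ⟨h, arg_mem_Ioo_of_im_neg
        (by rw [div_im_eq_cross]; exact div_neg_of_neg_of_pos h hpos)⟩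
    · exact .inl ⟨h, arg_mem_Ioo_of_im_pos (by rw [div_im_eq_cross]; positivity)⟩
  rw [hn]
  suffices (n : ℝ) = argJump z w by rw [this]
  rcases hz.lt_or_gt with hz | hz <;> rcases hw.lt_or_gt with hw | hw
  · have h1 := arg_mem_Ioo_of_im_neg hz
    have h2 := arg_mem_Ioo_of_im_neg hw
    rw [argJump, if_neg (by intro h; linarith [h.2.1]), if_neg (by intro h; linarith [h.1])]
    rw [key 0 (by push_cast; rcases hc with hc | hc <;> linarith)
      (by push_cast; rcases hc with hc | hc <;> linarith)]
    simp
  · have h1 := arg_mem_Ioo_of_im_neg hz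
    have h2 := arg_mem_Ioo_of_im_pos hw
    rcases hc with hc | hc
    · rw [argJump, if_neg (by intro h; linarith [h.2.2]), if_neg (by intro h; linarith [h.1]),
        key 0 (by push_cast; linarith) (by push_cast; linarith)]
      simp
    · rw [argJump, if_pos ⟨hz, hw, hc.1⟩,
        key (-1) (by push_cast; linarith) (by push_cast; linarith)]
      simp
  · have h1 := arg_mem_Ioo_of_im_pos hz
    have h2 := arg_mem_Ioo_of_im_neg hw
    rcases hc with hc | hc
    · rw [argJump, if_neg (by intro h; linarith [h.1]), if_pos ⟨hz, hw, hc.1⟩,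
        key 1 (by push_cast; linarith) (by push_cast; linarith)]
      simp
    · rw [argJump, if_neg (by intro h; linarith [h.1]), if_neg (by intro h; linarith [h.2.2]),
        key 0 (by push_cast; linarith) (by push_cast; linarith)]
      simp
  · have h1 := arg_mem_Ioo_of_im_pos hz
    have h2 := arg_mem_Ioo_of_im_pos hw
    rw [argJump, if_neg (by intro h; linarith [h.1]), if_neg (by intro h; linarith [h.2.1])]
    rw [key 0 (by push_cast; rcases hc with hc | hc <;> linarith)
      (by push_cast; rcases hc with hc | hc <;> linarith)]
    simp

lemma cross_ne_zero_of_not_collinear {A B C : ℂ} (h : ¬ Collinear ℝ ({A, B, C} : Set ℂ)) :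
    cross (B - A) (C - A) ≠ 0 := by
  intro h0
  apply h
  by_cases hAB : A = B
  · subst hAB
    simpa using collinear_pair ℝ A C
  have hne : B - A ≠ 0 := sub_ne_zero.2 (Ne.symm hAB)
  have him : ((C - A) / (B - A)).im = 0 := by rw [div_im_eq_cross, h0, zero_div]
  rw [collinear_iff_of_mem (p₀ := A) (by simp)]
  refine ⟨B - A, ?_⟩
  simp only [Set.mem_insert_iff, Set.mem_singleton_iff, forall_eq_or_imp, forall_eq]
  refine ⟨⟨0, by simp⟩, ⟨1, by simp⟩, ⟨((C - A) / (B - A)).re, ?_⟩⟩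
  have hr : ((((C - A) / (B - A)).re : ℝ) : ℂ) = (C - A) / (B - A) :=
    Complex.ext (by simp) (by simp [him])
  rw [Complex.real_smul, hr, div_mul_cancel₀ _ hne]
  simp

lemma mul_neg_of_convex_comb_eq_zero {P Q a b : ℝ} (ha : 0 ≤ a) (hb : 0 ≤ b) (hab : a + b = 1)
    (hP : P ≠ 0) (hQ : Q ≠ 0) (h : a * P + b * Q = 0) : P * Q < 0 := by
  by_contra! hc
  have hPQ : 0 < P * Q := lt_of_le_of_ne hc (mul_ne_zero hP hQ).symm
  have hP2 : 0 < P * P := mul_self_pos.2 hP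
  have h2 : a * (P * P) + b * (P * Q) = 0 := by linear_combination P * h
  have h3 := mul_nonneg ha hP2.le
  have h4 := mul_nonneg hb hPQ.le
  have ha0 : a = 0 := (mul_eq_zero.1 (by linarith : a * (P * P) = 0)).resolve_right hP2.ne'
  have hb0 : b = 0 := (mul_eq_zero.1 (by linarith : b * (P * Q) = 0)).resolve_right hPQ.ne'
  linarith

lemma segment_inter_segment_nonempty_iff {A B C D : ℂ}
    (hP : cross (B - A) (C - A) ≠ 0) (hQ : cross (B - A) (D - A) ≠ 0)
    (hR : cross (D - C) (A - C) ≠ 0) (hS : cross (D - C) (B - C) ≠ 0) :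
    (segment ℝ A B ∩ segment ℝ C D).Nonempty ↔
      cross (B - A) (C - A) * cross (B - A) (D - A) < 0 ∧
      cross (D - C) (A - C) * cross (D - C) (B - C) < 0 := by
  constructor
  · rintro ⟨x, ⟨a, b, ha, hb, hab, rfl⟩, ⟨c, d, hc, hd, hcd, hx⟩⟩
    have hre := congrArg Complex.re hx
    have him := congrArg Complex.im hx
    obtain rfl : b = 1 - a := by linarith
    obtain rfl : d = 1 - c := by linarith
    simp only [Complex.add_re, Complex.add_im, Complex.real_smul, Complex.re_ofReal_mul,
      Complex.im_ofReal_mul] at hre him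
    refine ⟨mul_neg_of_convex_comb_eq_zero hc hd hcd hP hQ ?_,
      mul_neg_of_convex_comb_eq_zero ha hb hab hR hS ?_⟩
    · simp only [cross, Complex.sub_re, Complex.sub_im]
      linear_combination (B.re - A.re) * him - (B.im - A.im) * hre
    · simp only [cross, Complex.sub_re, Complex.sub_im]
      linear_combination -(D.re - C.re) * him + (D.im - C.im) * hre
  · rintro ⟨h1, h2⟩
    have hPQ : cross (B - A) (C - A) - cross (B - A) (D - A) ≠ 0 := by
      intro h0
      rw [sub_eq_zero.1 h0] at h1
      nlinarith [mul_self_nonneg (cross (B - A) (D - A))]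
    have hRS : cross (D - C) (A - C) - cross (D - C) (B - C) =
        -(cross (B - A) (C - A) - cross (B - A) (D - A)) := by
      simp only [cross, Complex.sub_re, Complex.sub_im]; ring
    have bound : ∀ P Q : ℝ, P * Q < 0 → 0 ≤ P / (P - Q) ∧ 0 ≤ 1 - P / (P - Q) := by
      intro P Q h
      have hne : P - Q ≠ 0 := by
        intro h0
        rw [sub_eq_zero.1 h0] at h
        nlinarith [mul_self_nonneg Q]
      have e1 : P / (P - Q) = P * (P - Q) / (P - Q) ^ 2 := by field_simp
      have e2 : 1 - P / (P - Q) = -Q * (P - Q) / (P - Q) ^ 2 := by field_simp; ring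
      rw [e2, e1]
      exact ⟨div_nonneg (by nlinarith [sq_nonneg P]) (sq_nonneg _),
        div_nonneg (by nlinarith [sq_nonneg Q]) (sq_nonneg _)⟩
    obtain ⟨hs, hs'⟩ := bound _ _ h2
    obtain ⟨ht, ht'⟩ := bound _ _ h1
    refine ⟨_, ⟨_, _, hs', hs, by ring, rfl⟩, ⟨_, _, ht', ht, by ring, ?_⟩⟩
    rw [hRS]
    set W := cross (B - A) (C - A) - cross (B - A) (D - A) with hW
    apply Complex.ext <;>
    · simp only [Complex.add_re, Complex.add_im, Complex.real_smul, Complex.re_ofReal_mul,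
        Complex.im_ofReal_mul]
      field_simp
      rw [hW]
      simp only [cross, Complex.sub_re, Complex.sub_im]
      ring

lemma cross_div_div {d : ℂ} (hd : d ≠ 0) (z w : ℂ) :
    cross (z / d) (w / d) = cross z w / Complex.normSq d := by
  have hn := (Complex.normSq_pos.2 hd).ne'
  rw [cross, Complex.div_re, Complex.div_re, Complex.div_im, Complex.div_im, cross]
  field_simp
  rw [Complex.normSq_apply]
  ring

lemma cross_sub_sub_eq (A B X : ℂ) : cross (A - X) (B - X) = cross (B - A) (X - A) := by
  simp only [cross, Complex.sub_re, Complex.sub_im]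
  ring

lemma cross_sub_right_eq (C D X : ℂ) : cross (D - C) (X - D) = cross (D - C) (X - C) := by
  simp only [cross, Complex.sub_re, Complex.sub_im]
  ring

lemma isect_eq_argJump {A B C D : ℂ}
    (hP : cross (B - A) (C - A) ≠ 0) (hQ : cross (B - A) (D - A) ≠ 0)
    (hR : cross (D - C) (A - C) ≠ 0) (hS : cross (D - C) (B - C) ≠ 0) :
    isect (A, B) (C, D) = argJump ((A - D) / (D - C)) ((B - D) / (D - C)) -
      argJump ((A - C) / (D - C)) ((B - C) / (D - C)) := by
  have hDC : D - C ≠ 0 := by intro h; simp [h, cross] at hR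
  have hn : 0 < Complex.normSq (D - C) := Complex.normSq_pos.2 hDC
  have e5 : cross (D - C) (A - C) - cross (D - C) (B - C) =
        -(cross (B - A) (C - A) - cross (B - A) (D - A)) := by
    simp only [cross, Complex.sub_re, Complex.sub_im]; ring
  have hlt : ∀ x : ℝ, x / Complex.normSq (D - C) < 0 ↔ x < 0 := fun x => by
    rw [div_lt_iff₀ hn, zero_mul]
  have hgt : ∀ x : ℝ, 0 < x / Complex.normSq (D - C) ↔ 0 < x := fun x => by
    rw [lt_div_iff₀ hn, zero_mul]
  simp only [isect, argJump, segment_inter_segment_nonempty_iff hP hQ hR hS, cross_div_div hDC,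
    div_im_eq_cross, hlt, hgt, cross_sub_sub_eq A B, cross_sub_right_eq, mul_neg_iff]
  generalize cross (B - A) (C - A) = P at *
  generalize cross (B - A) (D - A) = Q at *
  generalize cross (D - C) (A - C) = R at *
  generalize cross (D - C) (B - C) = S at *
  clear hlt hgt
  rcases hP.lt_or_gt with hP | hP <;> rcases hQ.lt_or_gt with hQ | hQ <;>
    rcases hR.lt_or_gt with hR | hR <;> rcases hS.lt_or_gt with hS | hS <;>
    first
      | (exfalso; linarith)
      | simp [hP, hQ, hR, hS, hP.not_gt, hQ.not_gt, hR.not_gt, hS.not_gt]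

/-- The difference of the angles from a point `X` to the ends of `CD`, measured against `CD`. -/
noncomputable def endAngle (C D X : ℂ) : ℝ :=
  ((X - D) / (D - C)).arg - ((X - C) / (D - C)).arg

lemma oangle_sub_oangle {A B C D : ℂ}
    (hP : cross (B - A) (C - A) ≠ 0) (hQ : cross (B - A) (D - A) ≠ 0)
    (hR : cross (D - C) (A - C) ≠ 0) (hS : cross (D - C) (B - C) ≠ 0) :
    oangle D A B - oangle C A B =
      (endAngle C D B - endAngle C D A) + 2 * Real.pi * isect (A, B) (C, D) := by
  have hDC : D - C ≠ 0 := by intro h; simp [h, cross] at hR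
  have hn := (Complex.normSq_pos.2 hDC).ne'
  have h1 := arg_div_eq ((A - D) / (D - C)) ((B - D) / (D - C))
    (by rw [div_im_eq_cross, cross_sub_right_eq]; exact div_ne_zero hR hn)
    (by rw [div_im_eq_cross, cross_sub_right_eq]; exact div_ne_zero hS hn)
    (by rw [cross_div_div hDC, cross_sub_sub_eq]; exact div_ne_zero hQ hn)
  have h2 := arg_div_eq ((A - C) / (D - C)) ((B - C) / (D - C))
    (by rw [div_im_eq_cross]; exact div_ne_zero hR hn)
    (by rw [div_im_eq_cross]; exact div_ne_zero hS hn)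
    (by rw [cross_div_div hDC, cross_sub_sub_eq]; exact div_ne_zero hP hn)
  rw [div_div_div_cancel_right₀ hDC] at h1 h2
  rw [isect_eq_argJump hP hQ hR hS, oangle, oangle, h1, h2, endAngle, endAngle]
  ring

lemma oangle_self_sub_oangle_self {A C D : ℂ} (hR : cross (D - C) (A - C) ≠ 0) :
    oangle D A A - oangle C A A =
      (endAngle C D A - endAngle C D A) + 2 * Real.pi * isect (A, A) (C, D) := by
  have hC : A - C ≠ 0 := by intro h; simp [h, cross] at hR
  have hD : A - D ≠ 0 := by
    intro h
    rw [sub_eq_zero.1 h] at hR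
    exact hR (by rw [cross]; ring)
  have hI : isect (A, A) (C, D) = 0 := by
    rw [isect, if_neg]
    rintro ⟨x, hx, c, d, hc, hd, hcd, hx'⟩
    simp only [segment_same, Set.mem_singleton_iff] at hx
    subst hx
    apply hR
    obtain rfl : c = 1 - d := by linarith
    have hre := congrArg Complex.re hx'
    have him := congrArg Complex.im hx'
    simp only [Complex.add_re, Complex.add_im, Complex.real_smul, Complex.re_ofReal_mul,
      Complex.im_ofReal_mul] at hre him
    simp only [cross, Complex.sub_re, Complex.sub_im]
    linear_combination -(D.re - C.re) * him + (D.im - C.im) * hre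
  simp [oangle, div_self hC, div_self hD, hI]

lemma list_sum_map_sub {α : Type*} (L : List α) (f g : α → ℝ) :
    (L.map (fun e => f e - g e)).sum = (L.map f).sum - (L.map g).sum := by
  rw [eq_sub_iff_add_eq, ← List.sum_map_add]
  simp

lemma sum_cyc_sub (l : List ℂ) (G : ℂ → ℝ) :
    ((cyc l).map (fun e => G e.2 - G e.1)).sum = 0 := by
  have h1 : (cyc l).map (fun e => G e.1) = l.map G := by
    rw [show (fun e : ℂ × ℂ => G e.1) = G ∘ Prod.fst from rfl, ← List.map_map, cyc,
      List.map_fst_zip (by simp)]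
  have h2 : (cyc l).map (fun e => G e.2) = (l.rotate 1).map G := by
    rw [show (fun e : ℂ × ℂ => G e.2) = G ∘ Prod.snd from rfl, ← List.map_map, cyc,
      List.map_snd_zip (by simp)]
  rw [list_sum_map_sub, h1, h2, ((List.rotate_perm l 1).map G).sum_eq, sub_self]

/-- Moving the base point of the winding number along a single segment. -/
lemma wind_sub_wind (l : List ℂ) {C D : ℂ} (hC : C ∉ l) (hD : D ∉ l) (hCD : C ≠ D)
    (h : ∀ a ∈ C :: D :: l, ∀ b ∈ C :: D :: l, ∀ c ∈ C :: D :: l, a ≠ b → a ≠ c → b ≠ c →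
      cross (b - a) (c - a) ≠ 0) :
    wind l D - wind l C = ((cyc l).map (fun e => isect e (C, D))).sum := by
  have hedge : ∀ e ∈ cyc l, oangle D e.1 e.2 - oangle C e.1 e.2 =
      (endAngle C D e.2 - endAngle C D e.1) + 2 * Real.pi * isect e (C, D) := by
    rintro ⟨A, B⟩ he
    obtain ⟨hA, hB⟩ := List.of_mem_zip he
    rw [List.mem_rotate] at hB
    have nAC : A ≠ C := fun h => hC (h ▸ hA)
    have nAD : A ≠ D := fun h => hD (h ▸ hA)
    have nBC : B ≠ C := fun h => hC (h ▸ hB)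
    have nBD : B ≠ D := fun h => hD (h ▸ hB)
    have hR := h C (by simp) D (by simp) A (by simp [hA]) hCD nAC.symm nAD.symm
    have hS := h C (by simp) D (by simp) B (by simp [hB]) hCD nBC.symm nBD.symm
    by_cases hAB : A = B
    · subst hAB
      exact oangle_self_sub_oangle_self hR
    · exact oangle_sub_oangle
        (h A (by simp [hA]) B (by simp [hB]) C (by simp) hAB nAC nBC)
        (h A (by simp [hA]) B (by simp [hB]) D (by simp) hAB nAD nBD) hR hS
  have hsum : ((cyc l).map (fun e => oangle D e.1 e.2)).sum -
      ((cyc l).map (fun e => oangle C e.1 e.2)).sum =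
      2 * Real.pi * ((cyc l).map (fun e => isect e (C, D))).sum := by
    rw [← list_sum_map_sub, List.map_congr_left hedge, List.sum_map_add, sum_cyc_sub, zero_add,
      List.sum_map_mul_left]
  rw [wind, wind, ← sub_div, hsum, mul_div_cancel_left₀ _ (by positivity)]

lemma signedSum_cons (L P : List (ℂ × ℂ)) (f : ℂ × ℂ) :
    signedSum L (f :: P) = (L.map (fun e => isect e f)).sum + signedSum L P := by
  simp only [signedSum, List.map_cons, List.sum_cons, List.sum_map_add]

lemma wind_sub_wind_of_polygonal (l p : List ℂ) (P₀ P₁ : ℂ)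
    (hp0 : p.head? = some P₀) (hp1 : p.getLast? = some P₁)
    (hnd : p.Pairwise (· ≠ ·)) (hdisj : ∀ x ∈ p, x ∉ l)
    (h : ∀ a ∈ l ++ p, ∀ b ∈ l ++ p, ∀ c ∈ l ++ p, a ≠ b → a ≠ c → b ≠ c →
      cross (b - a) (c - a) ≠ 0) :
    wind l P₁ - wind l P₀ = signedSum (cyc l) (opairs p) := by
  induction p generalizing P₀ with
  | nil => simp at hp0
  | cons C q ih =>
    obtain rfl : C = P₀ := by simpa using hp0
    cases q with
    | nil =>
      obtain rfl : C = P₁ := by simpa using hp1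
      simp [signedSum, opairs]
    | cons D r =>
      have hsub : ∀ x ∈ C :: D :: l, x ∈ l ++ C :: D :: r := by
        intro x hx
        simp only [List.mem_cons, List.mem_append] at hx ⊢
        tauto
      have hsub' : ∀ x ∈ l ++ D :: r, x ∈ l ++ C :: D :: r := by
        intro x hx
        simp only [List.mem_cons, List.mem_append] at hx ⊢
        tauto
      have h1 := wind_sub_wind l (hdisj C (by simp)) (hdisj D (by simp))
        (List.rel_of_pairwise_cons hnd (by simp))
        (fun a ha b hb c hc => h a (hsub a ha) b (hsub b hb) c (hsub c hc))
      have h2 := ih D rfl (by simpa using hp1) hnd.of_cons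
        (fun x hx => hdisj x (List.mem_cons_of_mem _ hx))
        (fun a ha b hb c hc => h a (hsub' a ha) b (hsub' b hb) c (hsub' c hc))
      have h3 : opairs (C :: D :: r) = (C, D) :: opairs (D :: r) := rfl
      rw [h3, signedSum_cons, ← h1, ← h2]
      ring

theorem stmt15 (l p : List ℂ) (hl : l ≠ []) (hp : p ≠ [])
    (P₀ P₁ : ℂ) (hp0 : p.head? = some P₀) (hp1 : p.getLast? = some P₁)
    (h : GenPos (l ++ p)) :
    wind l P₁ - wind l P₀ = signedSum (cyc l) (opairs p) := by
  obtain ⟨hne, hcol, -⟩ := h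
  obtain ⟨-, hnd, hlp⟩ := List.pairwise_append.1 hne
  exact wind_sub_wind_of_polygonal l p P₀ P₁ hp0 hp1 hnd
    (fun x hx hxl => hlp x hxl x hx rfl)
    (fun a ha b hb c hc hab hac hbc =>
      cross_ne_zero_of_not_collinear (hcol a ha b hb c hc hab hac hbc))
end
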